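/- Let Ω ⊆ ℝ^n be open and let L be the second-order operator Lu = Σ_{k=1}^r X_k² u + Yu + au, where X₁,...,X_r and Y are C^∞ vector fields on Ω and a ∈ C^∞(Ω) satisfies a ≤ 0. Let u ∈ C²(Ω) satisfy Lu ≥ 0 in Ω, and let Γ be an integral curve of a vector field Z ∈ £(X₁,...,X_r). If u attains a nonnegative maximum over Ω at some point of Γ, then u equals that maximum at every point of Γ. -/

import Mathlib

open Set Finset

noncomputable section

/-- Derivative of `f` along the vector field `X`. -/
def vApp {N : ℕ} (X : (Fin N → ℝ) → (Fin N → ℝ)) (f : (Fin N → ℝ) → ℝ) (x : Fin N → ℝ) : ℝ :=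
  fderiv ℝ f x (X x)

/-- Lie bracket of vector fields. -/
def lieBr {N : ℕ} (X Y : (Fin N → ℝ) → (Fin N → ℝ)) : (Fin N → ℝ) → (Fin N → ℝ) :=
  fun x => fderiv ℝ Y x (X x) - fderiv ℝ X x (Y x)

/-- `£(S)`: the smallest `C^∞`-module of vector fields containing `S`
and closed under Lie bracket. -/
inductive LieSpan {N : ℕ} (Ω : Set (Fin N → ℝ)) (S : Set ((Fin N → ℝ) → (Fin N → ℝ))) :
    ((Fin N → ℝ) → (Fin N → ℝ)) → Prop
  | base : ∀ X ∈ S, LieSpan Ω S X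
  | smul : ∀ (f : (Fin N → ℝ) → ℝ) (X : (Fin N → ℝ) → (Fin N → ℝ)),
      ContDiffOn ℝ (⊤ : ℕ∞) f Ω → LieSpan Ω S X → LieSpan Ω S (fun x => f x • X x)
  | add : ∀ X Y, LieSpan Ω S X → LieSpan Ω S Y → LieSpan Ω S (fun x => X x + Y x)
  | bracket : ∀ X Y, LieSpan Ω S X → LieSpan Ω S Y → LieSpan Ω S (lieBr X Y)

open Filter Topology Metric

section Invariance

variable {n : ℕ}

/-- `X` is tangent to `F` in the sense of Bony: it is orthogonal to every `ν` such that the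
Euclidean ball centred at `x + ν` and touching `x ∈ F` contains no point of `F`. -/
def IsBonyTangent (F : Set (Fin n → ℝ)) (X : (Fin n → ℝ) → (Fin n → ℝ)) : Prop :=
  ∀ x ∈ F, ∀ ν : Fin n → ℝ,
    (∀ z ∈ F, ν ⬝ᵥ ν ≤ (z - x - ν) ⬝ᵥ (z - x - ν)) → X x ⬝ᵥ ν = 0

theorem norm_sq_le_dotProduct_self (v : Fin n → ℝ) : ‖v‖ ^ 2 ≤ v ⬝ᵥ v := by
  have h0 : 0 ≤ v ⬝ᵥ v := Finset.sum_nonneg fun i _ => mul_self_nonneg _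
  have : ‖v‖ ≤ √(v ⬝ᵥ v) := by
    refine (pi_norm_le_iff_of_nonneg (Real.sqrt_nonneg _)).2 fun i => ?_
    refine Real.le_sqrt_of_sq_le ?_
    rw [Real.norm_eq_abs, sq_abs, sq]
    exact Finset.single_le_sum (f := fun i => v i * v i)
      (fun i _ => mul_self_nonneg _) (Finset.mem_univ i)
  exact (Real.le_sqrt (norm_nonneg _) h0).1 this

theorem dotProduct_le_norm_mul_norm (v w : Fin n → ℝ) : v ⬝ᵥ w ≤ n * (‖v‖ * ‖w‖) := by
  have : v ⬝ᵥ w ≤ ∑ _i : Fin n, ‖v‖ * ‖w‖ := by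
    refine Finset.sum_le_sum fun i _ => ?_
    refine (le_abs_self _).trans ?_
    rw [abs_mul]
    exact mul_le_mul (norm_le_pi_norm v i) (norm_le_pi_norm w i) (abs_nonneg _) (norm_nonneg _)
  simpa using this

theorem dotProduct_self_nonneg' (v : Fin n → ℝ) : 0 ≤ v ⬝ᵥ v :=
  (sq_nonneg _).trans (norm_sq_le_dotProduct_self v)

theorem continuous_dotProduct_self : Continuous fun v : Fin n → ℝ => v ⬝ᵥ v := by
  unfold dotProduct; fun_prop

theorem HasDerivAt.dotProduct_self {γ : ℝ → Fin n → ℝ} {γ' : Fin n → ℝ} {t : ℝ}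
    (h : HasDerivAt γ γ' t) :
    HasDerivAt (fun s => γ s ⬝ᵥ γ s) (2 * (γ' ⬝ᵥ γ t)) t := by
  have h1 : ∀ i ∈ Finset.univ, HasDerivAt (fun s => γ s i * γ s i)
      (γ' i * γ t i + γ t i * γ' i) t :=
    fun i _ => (hasDerivAt_pi.1 h i).mul (hasDerivAt_pi.1 h i)
  have := HasDerivAt.fun_sum h1
  refine this.congr_deriv ?_
  simp only [dotProduct, Finset.mul_sum]
  exact Finset.sum_congr rfl fun i _ => by ring

/-- One-sided local invariance of `F` under integral curves of a tangent field. -/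
theorem IsBonyTangent.eventually_mem_right {Ω F : Set (Fin n → ℝ)} (hΩ : IsOpen Ω)
    (hFΩ : F ⊆ Ω) (hF : ∀ K ⊆ Ω, IsCompact K → IsCompact (F ∩ K))
    {X : (Fin n → ℝ) → (Fin n → ℝ)} (hX : ContDiffOn ℝ 1 X Ω) (hT : IsBonyTangent F X)
    {γ : ℝ → Fin n → ℝ} {t₀ : ℝ} (hγ : ∀ᶠ t in 𝓝 t₀, HasDerivAt γ (X (γ t)) t)
    (h0 : γ t₀ ∈ F) : ∀ᶠ t in 𝓝[≥] t₀, γ t ∈ F := by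
  obtain ⟨L, s, hs, hL⟩ := (hX.contDiffAt (hΩ.mem_nhds (hFΩ h0))).exists_lipschitzOnWith
  obtain ⟨R, hR, hRs⟩ := Metric.nhds_basis_closedBall.mem_iff.1
    (inter_mem hs (hΩ.mem_nhds (hFΩ h0)))
  obtain ⟨ρ, hρ, rfl⟩ : ∃ ρ > 0, R = 2 * ρ := ⟨R / 2, by positivity, by ring⟩
  set F₁ := F ∩ closedBall (γ t₀) (2 * ρ) with hF₁
  have hF₁c : IsCompact F₁ := hF _ (fun z hz => (hRs hz).2) (isCompact_closedBall _ _)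
  have h0₁ : γ t₀ ∈ F₁ := ⟨h0, mem_closedBall_self (by positivity)⟩
  set D : (Fin n → ℝ) → ℝ := fun p => sInf ((fun z => (p - z) ⬝ᵥ (p - z)) '' F₁) with hD
  have hDc : Continuous D := by
    refine hF₁c.continuous_sInf (f := fun p z => (p - z) ⬝ᵥ (p - z)) ?_
    exact continuous_dotProduct_self.comp (continuous_fst.sub continuous_snd)
  have hmin : ∀ p, ∃ y ∈ F₁, D p = (p - y) ⬝ᵥ (p - y) := fun p =>
    hF₁c.exists_sInf_image_eq ⟨_, h0₁⟩
      (continuous_dotProduct_self.comp (continuous_const.sub continuous_id)).continuousOn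
  have hDle : ∀ p, ∀ y ∈ F₁, D p ≤ (p - y) ⬝ᵥ (p - y) := fun p y hy =>
    csInf_le ⟨0, by rintro _ ⟨z, -, rfl⟩; exact dotProduct_self_nonneg' _⟩ ⟨y, hy, rfl⟩
  have hnear : ∀ᶠ t in 𝓝 t₀, (γ t - γ t₀) ⬝ᵥ (γ t - γ t₀) < ρ ^ 2 := by
    have hc : ContinuousAt (fun t => (γ t - γ t₀) ⬝ᵥ (γ t - γ t₀)) t₀ :=
      continuous_dotProduct_self.continuousAt.comp
        (hγ.self_of_nhds.continuousAt.sub continuousAt_const)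
    exact hc.eventually (gt_mem_nhds (by simp; positivity))
  obtain ⟨δ, hδ, hδs⟩ := Metric.nhds_basis_closedBall.mem_iff.1 (hγ.and hnear)
  have hIcc : ∀ t ∈ Icc t₀ (t₀ + δ), HasDerivAt γ (X (γ t)) t ∧
      (γ t - γ t₀) ⬝ᵥ (γ t - γ t₀) < ρ ^ 2 := fun t ht => hδs (by
    rw [Metric.mem_closedBall, Real.dist_eq, abs_le]; constructor <;> linarith [ht.1, ht.2])
  have key : ∀ t ∈ Icc t₀ (t₀ + δ), D (γ t) ≤ gronwallBound 0 (2 * (n * L)) 0 (t - t₀) := by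
    refine le_gronwallBound_of_liminf_deriv_right_le (f := fun t => D (γ t))
      (f' := fun t => 2 * (n * L) * D (γ t)) ?_ ?_ ?_ (by simp)
    · exact fun t ht => (hDc.continuousAt.comp (hIcc t ht).1.continuousAt).continuousWithinAt
    · intro t ht r hr
      obtain ⟨hd, hb⟩ := hIcc t (Ico_subset_Icc_self ht)
      obtain ⟨y, hy, hDy⟩ := hmin (γ t)
      have hyb : (γ t - y) ⬝ᵥ (γ t - y) < ρ ^ 2 := hDy ▸ (hDle _ _ h0₁).trans_lt hb
      have hn1 : ‖γ t - γ t₀‖ < ρ :=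
        lt_of_pow_lt_pow_left₀ 2 hρ.le ((norm_sq_le_dotProduct_self _).trans_lt hb)
      have hn2 : X y ⬝ᵥ (γ t - y) = 0 := by
        refine hT y hy.1 _ fun z hz => ?_
        have e : z - y - (γ t - y) = -(γ t - z) := by abel
        rw [e, neg_dotProduct_neg]
        by_cases hz1 : z ∈ closedBall (γ t₀) (2 * ρ)
        · exact hDy ▸ hDle _ _ ⟨hz, hz1⟩
        · rw [mem_closedBall, dist_eq_norm, not_le] at hz1
          have h3 : ρ < ‖γ t - z‖ := by
            have : ‖z - γ t₀‖ ≤ ‖γ t - γ t₀‖ + ‖γ t - z‖ := by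
              have e : z - γ t₀ = (γ t - γ t₀) - (γ t - z) := by abel
              rw [e]; exact norm_sub_le _ _
            linarith
          have := norm_sq_le_dotProduct_self (γ t - z)
          nlinarith
      have hlip : ‖X (γ t) - X y‖ ≤ L * ‖γ t - y‖ := by
        refine hL.norm_sub_le (hRs ?_).1 (hRs hy.2).1
        rw [mem_closedBall, dist_eq_norm]; linarith
      have hbound : 2 * (X (γ t) ⬝ᵥ (γ t - y)) ≤ 2 * (n * L) * D (γ t) := by
        have h1 : X (γ t) ⬝ᵥ (γ t - y) = (X (γ t) - X y) ⬝ᵥ (γ t - y) := by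
          rw [sub_dotProduct, hn2, sub_zero]
        rw [h1, hDy]
        calc 2 * ((X (γ t) - X y) ⬝ᵥ (γ t - y)) ≤ 2 * (n * (‖X (γ t) - X y‖ * ‖γ t - y‖)) := by
              gcongr; exact dotProduct_le_norm_mul_norm _ _
          _ ≤ 2 * (n * (L * ‖γ t - y‖ * ‖γ t - y‖)) := by gcongr
          _ = 2 * (n * L) * ‖γ t - y‖ ^ 2 := by ring
          _ ≤ _ := by gcongr; exact norm_sq_le_dotProduct_self _
      have hder := (hd.sub_const y).dotProduct_self
      have hslope := (hasDerivAt_iff_tendsto_slope.1 hder).mono_left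
        (nhdsWithin_mono t (fun z (hz : t < z) => hz.ne'))
      refine Eventually.frequently ?_
      filter_upwards [hslope.eventually (gt_mem_nhds (hbound.trans_lt hr)), self_mem_nhdsWithin]
        with z hz hz1
      refine lt_of_le_of_lt ?_ hz
      rw [slope_def_field, div_eq_inv_mul]
      have : 0 ≤ (z - t)⁻¹ := inv_nonneg.2 (sub_nonneg.2 (le_of_lt hz1))
      gcongr
      · exact hDle _ _ hy
      · exact hDy.ge
    · have h1 := hDle (γ t₀) _ h0₁
      rw [sub_self, dotProduct_zero] at h1
      simpa using h1
  filter_upwards [Icc_mem_nhdsGE (show t₀ < t₀ + δ by linarith)] with t ht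
  obtain ⟨y, hy, hDy⟩ := hmin (γ t)
  have h1 := key t ht
  rw [gronwallBound_ε0_δ0, hDy] at h1
  have h2 : γ t - y = 0 := dotProduct_self_eq_zero.1 (le_antisymm h1 (dotProduct_self_nonneg' _))
  rw [sub_eq_zero.1 h2]
  exact hy.1

theorem IsBonyTangent.neg {F : Set (Fin n → ℝ)} {X : (Fin n → ℝ) → (Fin n → ℝ)}
    (hT : IsBonyTangent F X) : IsBonyTangent F (fun x => -X x) := fun x hx ν hν => by
  rw [neg_dotProduct, hT x hx ν hν, neg_zero]

/-- A relatively closed set is invariant under integral curves of a tangent field. -/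
theorem IsBonyTangent.mem_of_integralCurve {Ω F : Set (Fin n → ℝ)} (hΩ : IsOpen Ω)
    (hFΩ : F ⊆ Ω) (hF : ∀ K ⊆ Ω, IsCompact K → IsCompact (F ∩ K))
    {X : (Fin n → ℝ) → (Fin n → ℝ)} (hX : ContDiffOn ℝ 1 X Ω) (hT : IsBonyTangent F X)
    {I : Set ℝ} (hI : IsOpen I) (hI' : IsPreconnected I)
    {γ : ℝ → Fin n → ℝ} (hγΩ : ∀ t ∈ I, γ t ∈ Ω) (hγ : ∀ t ∈ I, HasDerivAt γ (X (γ t)) t)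
    {t₀ : ℝ} (ht₀ : t₀ ∈ I) (h0 : γ t₀ ∈ F) : ∀ t ∈ I, γ t ∈ F := by
  have hloc : ∀ t ∈ I, γ t ∈ F → ∀ᶠ s in 𝓝 t, γ s ∈ F := by
    intro t ht h
    rw [← nhdsLE_sup_nhdsGE, eventually_sup]
    have hev : ∀ᶠ s in 𝓝 t, HasDerivAt γ (X (γ s)) s := by
      filter_upwards [hI.mem_nhds ht] with s hs using hγ s hs
    refine ⟨?_, hT.eventually_mem_right hΩ hFΩ hF hX hev h⟩
    have hneg : Tendsto (fun s : ℝ => -s) (𝓝 (-t)) (𝓝 t) := by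
      simpa using (continuous_neg.tendsto (-t) : Tendsto (fun s : ℝ => -s) _ _)
    have h1 : ∀ᶠ s in 𝓝[≥] (-t), γ (-s) ∈ F := by
      refine hT.neg.eventually_mem_right (γ := fun s => γ (-s)) hΩ hFΩ hF hX.neg ?_ (by simpa)
      filter_upwards [hneg.eventually hev] with s hs
      exact (hs.scomp s (hasDerivAt_neg s)).congr_deriv (by simp)
    have h2 : Tendsto (fun s : ℝ => -s) (𝓝[≤] t) (𝓝[≥] (-t)) :=
      tendsto_neg_nhdsLE
    simpa using h2.eventually h1
  have hsub : I ⊆ {t | t ∈ I ∧ γ t ∈ F} := by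
    refine hI'.subset_of_closure_inter_subset ?_ ⟨t₀, ht₀, ht₀, h0⟩ ?_
    · rw [isOpen_iff_mem_nhds]
      rintro t ⟨ht, h⟩
      filter_upwards [hI.mem_nhds ht, hloc t ht h] with s hs h' using ⟨hs, h'⟩
    · rintro t ⟨hcl, ht⟩
      refine ⟨ht, ?_⟩
      obtain ⟨R, hR, hRs⟩ := Metric.nhds_basis_closedBall.mem_iff.1 (hΩ.mem_nhds (hγΩ t ht))
      have hc := (hF _ hRs (isCompact_closedBall _ _)).isClosed
      have hcont := (hγ t ht).continuousAt
      refine (hc.mem_of_frequently_of_tendsto (b := 𝓝 t) (f := γ) ?_ hcont).1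
      refine ((mem_closure_iff_frequently.1 hcl).and_eventually
        (hcont.eventually (closedBall_mem_nhds _ hR))).mono ?_
      exact fun s hs => ⟨hs.1.2, hs.2⟩
  exact fun t ht => (hsub ht).2

end Invariance

section Flow

variable {E : Type*} [NormedAddCommGroup E] [NormedSpace ℝ E]

/-- Existence of a local flow, jointly continuous at the base point and staying in `Ω`. -/
theorem exists_local_flow [CompleteSpace E] {Ω : Set E} (hΩ : IsOpen Ω) {X : E → E} (hX : ContDiffOn ℝ 1 X Ω)
    {x : E} (hx : x ∈ Ω) :
    ∃ Φ : E × ℝ → E, ContinuousAt Φ (x, 0) ∧ Φ (x, 0) = x ∧ ∃ δ > 0, ∀ p ∈ ball x δ,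
      Φ (p, 0) = p ∧ ∀ t ∈ Ioo (-δ) δ, Φ (p, t) ∈ Ω ∧
        HasDerivAt (fun s => Φ (p, s)) (X (Φ (p, t))) t := by
  obtain ⟨ε, hε, a, r, L, K, hr, hpl⟩ :=
    IsPicardLindelof.of_contDiffAt_one (hX.contDiffAt (hΩ.mem_nhds hx))
  obtain ⟨Φ, hΦ, hc⟩ := (hpl 0).exists_forall_mem_closedBall_eq_hasDerivWithinAt_continuousOn
  have hr' : (0 : ℝ) < r := hr
  have hca : ContinuousAt Φ (x, 0) := hc.continuousAt
    (prod_mem_nhds (closedBall_mem_nhds _ hr') (Icc_mem_nhds (by linarith) (by linarith)))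
  have hx0 : Φ (x, 0) = x := (hΦ x (mem_closedBall_self hr'.le)).1
  have hev : ∀ᶠ q in 𝓝 (x, (0 : ℝ)), Φ q ∈ Ω :=
    hca.eventually (hΩ.mem_nhds (by rwa [hx0]))
  obtain ⟨δ, hδ, hδs⟩ := Metric.mem_nhds_iff.1 hev
  refine ⟨Φ, hca, hx0, min δ (min r ε), by positivity, fun p hp => ?_⟩
  have hp1 : p ∈ closedBall x r := by
    refine ball_subset_closedBall (ball_subset_ball ?_ hp)
    exact (min_le_right _ _).trans (min_le_left _ _)
  refine ⟨(hΦ p hp1).1, fun t ht => ⟨?_, ?_⟩⟩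
  · refine hδs ?_
    rw [← ball_prod_same]
    refine ⟨ball_subset_ball (min_le_left _ _) hp, ?_⟩
    rw [mem_ball, Real.dist_eq, sub_zero, abs_lt]
    have := min_le_left δ (min r ε)
    constructor <;> linarith [ht.1, ht.2]
  · have := (min_le_right δ (min (r : ℝ) ε)).trans (min_le_right _ _)
    have h1 : 0 - ε < t := by linarith [ht.1]
    have h2 : t < 0 + ε := by linarith [ht.2]
    exact ((hΦ p hp1).2 t ⟨h1.le, h2.le⟩).hasDerivAt (Icc_mem_nhds h1 h2)

/-- Second-order Taylor expansion of a flow, uniform in the starting point. -/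
theorem flow_taylor_two {Ω : Set E} (hΩ : IsOpen Ω) {X : E → E} (hX : ContDiffOn ℝ 1 X Ω)
    {x : E} (hx : x ∈ Ω) {Φ : E × ℝ → E} (hc : ContinuousAt Φ (x, 0)) (hx0 : Φ (x, 0) = x)
    {δ : ℝ} (hδ : 0 < δ) (hΦ : ∀ p ∈ ball x δ, Φ (p, 0) = p ∧ ∀ t ∈ Ioo (-δ) δ,
      Φ (p, t) ∈ Ω ∧ HasDerivAt (fun s => Φ (p, s)) (X (Φ (p, t))) t)
    {η : ℝ} (hη : 0 < η) : ∃ δ' > 0, ∀ p ∈ ball x δ', ∀ t ∈ Ico 0 δ',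
      ‖Φ (p, t) - p - t • X p - (t ^ 2 / 2) • fderiv ℝ X x (X x)‖ ≤ η * t ^ 2 := by
  set W : E → E := fun y => fderiv ℝ X y (X y)
  have hWc : ContinuousAt W x :=
    ((hX.continuousOn_fderiv_of_isOpen hΩ le_rfl).clm_apply hX.continuousOn).continuousAt
      (hΩ.mem_nhds hx)
  have hev : ∀ᶠ q in 𝓝 (x, (0 : ℝ)), dist (W (Φ q)) (W x) < η := by
    have h1 : ContinuousAt (fun q => W (Φ q)) (x, (0 : ℝ)) :=
      ContinuousAt.comp (g := W) (by rwa [hx0]) hc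
    have h2 := h1.eventually (ball_mem_nhds _ hη)
    simpa only [hx0, mem_ball] using h2
  obtain ⟨δ₁, hδ₁, hδ₁s⟩ := Metric.mem_nhds_iff.1 hev
  refine ⟨min δ δ₁, by positivity, fun p hp t ht => ?_⟩
  have hp' := hΦ p (ball_subset_ball (min_le_left _ _) hp)
  have hmem : ∀ s ∈ Icc 0 t, s ∈ Ioo (-δ) δ := fun s hs =>
    ⟨by linarith [hs.1], lt_of_le_of_lt hs.2 (ht.2.trans_le (min_le_left _ _))⟩
  have hW : ∀ s ∈ Icc 0 t, ‖W (Φ (p, s)) - W x‖ ≤ η := fun s hs => by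
    have : dist (W (Φ (p, s))) (W x) < η := hδ₁s (by
      rw [← ball_prod_same]
      refine ⟨ball_subset_ball (min_le_right _ _) hp, ?_⟩
      rw [mem_ball, Real.dist_eq, sub_zero, abs_of_nonneg hs.1]
      exact lt_of_le_of_lt hs.2 (ht.2.trans_le (min_le_right _ _)))
    rw [← dist_eq_norm]; exact this.le
  have hXd : ∀ s ∈ Icc 0 t, HasDerivAt (fun s => X (Φ (p, s))) (W (Φ (p, s))) s := fun s hs => by
    obtain ⟨h1, h2⟩ := hp'.2 s (hmem s hs)
    exact ((hX.differentiableOn one_ne_zero).differentiableAt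
      (hΩ.mem_nhds h1)).hasFDerivAt.comp_hasDerivAt s h2
  have hfirst : ∀ s ∈ Icc 0 t, ‖X (Φ (p, s)) - X p - s • W x‖ ≤ η * s := by
    intro s hs
    have := norm_image_sub_le_of_norm_deriv_le_segment' (a := 0) (b := t)
      (f := fun s => X (Φ (p, s)) - s • W x) (f' := fun s => W (Φ (p, s)) - W x) (C := η)
      (fun s hs => by
        have := ((hXd s hs).fun_sub ((hasDerivAt_id s).smul_const (W x))).hasDerivWithinAt
          (s := Icc 0 t)
        simpa using this)
      (fun s hs => hW s (Ico_subset_Icc_self hs)) s hs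
    simp only [zero_smul, sub_zero, hp'.1] at this
    rwa [sub_right_comm]
  have := norm_image_sub_le_of_norm_deriv_le_segment' (a := 0) (b := t)
      (f := fun s => Φ (p, s) - s • X p - (s ^ 2 / 2) • W x)
      (f' := fun s => X (Φ (p, s)) - X p - s • W x) (C := η * t)
      (fun s hs => by
        have h2 : HasDerivAt (fun s : ℝ => s ^ 2 / 2) s s := by
          simpa using (hasDerivAt_pow 2 s).div_const 2
        have := (((hp'.2 s (hmem s hs)).2.fun_sub ((hasDerivAt_id s).smul_const (X p))).fun_sub
          (h2.smul_const (W x))).hasDerivWithinAt (s := Icc 0 t)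
        simpa using this)
      (fun s hs => (hfirst s (Ico_subset_Icc_self hs)).trans (by gcongr; exact hs.2.le))
      t ⟨ht.1, le_rfl⟩
  simp only [hp'.1, zero_smul, sub_zero, ne_eq, OfNat.ofNat_ne_zero, not_false_eq_true, zero_pow,
    zero_div] at this
  calc _ = ‖Φ (p, t) - t • X p - (t ^ 2 / 2) • W x - p‖ := by congr 1; abel
    _ ≤ _ := this
    _ = _ := by ring

end Flow

section Commutator

variable {n : ℕ}

/-- `p` is a curve in `F` for small positive times with `p t = x + t b + t² c + o(t²)`. -/
def HasTwoJet (F : Set (Fin n → ℝ)) (x b c : Fin n → ℝ) (p : ℝ → Fin n → ℝ) : Prop :=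
  (∀ᶠ t in 𝓝[>] (0 : ℝ), p t ∈ F) ∧
    Tendsto (fun t : ℝ => (t ^ 2)⁻¹ • (p t - x - t • b)) (𝓝[>] 0) (𝓝 c)

/-- Following a tangent field for time `t` from the point `p t`. -/
theorem HasTwoJet.exists_flow {Ω F : Set (Fin n → ℝ)} (hΩ : IsOpen Ω)
    (hFΩ : F ⊆ Ω) (hF : ∀ K ⊆ Ω, IsCompact K → IsCompact (F ∩ K))
    {X : (Fin n → ℝ) → (Fin n → ℝ)} (hX : ContDiffOn ℝ 1 X Ω) (hT : IsBonyTangent F X)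
    {x b c : Fin n → ℝ} (hx : x ∈ F) {p : ℝ → Fin n → ℝ} (hp : HasTwoJet F x b c p) :
    ∃ p', HasTwoJet F x (b + X x)
      (c + fderiv ℝ X x b + (1 / 2 : ℝ) • fderiv ℝ X x (X x)) p' := by
  obtain ⟨Φ, hΦc, hΦx, δ, hδ, hΦ⟩ := exists_local_flow hΩ hX (hFΩ hx)
  have ht0 : Tendsto (fun t : ℝ => t) (𝓝[>] 0) (𝓝 0) := tendsto_id.mono_left nhdsWithin_le_nhds
  have hpos : ∀ᶠ t : ℝ in 𝓝[>] 0, 0 < t := self_mem_nhdsWithin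
  have hb : Tendsto (fun t : ℝ => t⁻¹ • (p t - x)) (𝓝[>] 0) (𝓝 b) := by
    have := (ht0.smul hp.2).add_const b
    rw [zero_smul, zero_add] at this
    refine this.congr' ?_
    filter_upwards [hpos] with t ht
    have h : t ≠ 0 := ht.ne'
    rw [smul_smul, smul_sub, smul_smul]
    have e1 : t * (t ^ 2)⁻¹ = t⁻¹ := by field_simp
    rw [e1, inv_mul_cancel₀ h, one_smul, sub_add_cancel]
  have hpx0 : Tendsto (fun t : ℝ => p t - x) (𝓝[>] 0) (𝓝 0) := by
    have := ht0.smul hb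
    rw [zero_smul] at this
    refine this.congr' ?_
    filter_upwards [hpos] with t ht
    rw [smul_inv_smul₀ ht.ne']
  have hpx : Tendsto p (𝓝[>] 0) (𝓝 x) := by simpa using hpx0.add_const x
  have hXb : Tendsto (fun t : ℝ => t⁻¹ • (X (p t) - X x)) (𝓝[>] 0) (𝓝 (fderiv ℝ X x b)) := by
    have hd := ((hX.differentiableOn one_ne_zero).differentiableAt
      (hΩ.mem_nhds (hFΩ hx))).hasFDerivAt
    have := hd.hasFDerivWithinAt (s := univ) |>.lim hpx0 (by simp) hb
    simpa using this
  have hrem : Tendsto (fun t : ℝ => (t ^ 2)⁻¹ • (Φ (p t, t) - p t - t • X (p t)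
      - (t ^ 2 / 2) • fderiv ℝ X x (X x))) (𝓝[>] 0) (𝓝 0) := by
    rw [Metric.tendsto_nhds]
    intro ε hε
    obtain ⟨δ', hδ', h⟩ := flow_taylor_two hΩ hX (hFΩ hx) hΦc hΦx hδ hΦ (half_pos hε)
    filter_upwards [hpx.eventually (ball_mem_nhds _ hδ'), Ioo_mem_nhdsGT hδ'] with t h1 h2
    have := h _ h1 t ⟨h2.1.le, h2.2⟩
    have ht2 : 0 < t ^ 2 := pow_pos h2.1 2
    rw [dist_zero_right, norm_smul, norm_inv, Real.norm_of_nonneg ht2.le,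
      inv_mul_lt_iff₀ ht2]
    nlinarith
  refine ⟨fun t => Φ (p t, t), ?_, ?_⟩
  · filter_upwards [hp.1, hpx.eventually (ball_mem_nhds _ hδ), Ioo_mem_nhdsGT hδ]
      with t h1 h2 h3
    obtain ⟨h4, h5⟩ := hΦ _ h2
    exact hT.mem_of_integralCurve hΩ hFΩ hF hX isOpen_Ioo isPreconnected_Ioo
      (γ := fun s => Φ (p t, s)) (fun s hs => (h5 s hs).1) (fun s hs => (h5 s hs).2)
      (t₀ := 0) ⟨by linarith, hδ⟩ (by simpa only [h4] using h1) t ⟨by linarith [h3.1], h3.2⟩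
  · have := ((hp.2.add hXb).add_const ((1 / 2 : ℝ) • fderiv ℝ X x (X x))).add hrem
    rw [add_zero] at this
    refine this.congr' ?_
    filter_upwards [hpos] with t ht
    have h : t ≠ 0 := ht.ne'
    ext i
    simp only [Pi.add_apply, Pi.sub_apply, Pi.smul_apply, smul_eq_mul]
    field_simp
    ring

/-- The Lie bracket of tangent fields points into the half space opposite to each normal. -/
theorem IsBonyTangent.lieBr_dotProduct_nonpos {Ω F : Set (Fin n → ℝ)} (hΩ : IsOpen Ω)
    (hFΩ : F ⊆ Ω) (hF : ∀ K ⊆ Ω, IsCompact K → IsCompact (F ∩ K))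
    {X Y : (Fin n → ℝ) → (Fin n → ℝ)} (hX : ContDiffOn ℝ 1 X Ω) (hY : ContDiffOn ℝ 1 Y Ω)
    (hTX : IsBonyTangent F X) (hTY : IsBonyTangent F Y) {x : Fin n → ℝ} (hx : x ∈ F)
    {ν : Fin n → ℝ} (hν : ∀ z ∈ F, ν ⬝ᵥ ν ≤ (z - x - ν) ⬝ᵥ (z - x - ν)) :
    lieBr X Y x ⬝ᵥ ν ≤ 0 := by
  have h0 : HasTwoJet F x 0 0 (fun _ => x) := ⟨by simp [hx], by simp⟩
  obtain ⟨p₁, h1⟩ := h0.exists_flow hΩ hFΩ hF hX hTX hx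
  obtain ⟨p₂, h2⟩ := h1.exists_flow hΩ hFΩ hF hY hTY hx
  obtain ⟨p₃, h3⟩ := h2.exists_flow hΩ hFΩ hF hX.neg hTX.neg hx
  obtain ⟨p₄, h4⟩ := h3.exists_flow hΩ hFΩ hF hY.neg hTY.neg hx
  obtain ⟨hm, hlim⟩ : HasTwoJet F x 0 (lieBr X Y x) p₄ := by
    convert h4 using 1
    · abel
    · have e1 : fderiv ℝ (fun y => -X y) x = -fderiv ℝ X x := fderiv_fun_neg
      have e2 : fderiv ℝ (fun y => -Y y) x = -fderiv ℝ Y x := fderiv_fun_neg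
      rw [e1, e2, lieBr]
      simp only [map_add, map_neg, map_zero, neg_apply]
      module
  set e : ℝ → Fin n → ℝ := fun t => (t ^ 2)⁻¹ • (p₄ t - x - t • (0 : Fin n → ℝ)) with he
  have hle : ∀ᶠ t : ℝ in 𝓝[>] 0, 2 * (e t ⬝ᵥ ν) ≤ t ^ 2 * (e t ⬝ᵥ e t) := by
    filter_upwards [hm, self_mem_nhdsWithin] with t ht ht0
    have ht2 : (0 : ℝ) < t ^ 2 := pow_pos ht0 2
    have hz : p₄ t - x = t ^ 2 • e t := by
      rw [he]; simp only [smul_zero, sub_zero]; rw [smul_inv_smul₀ ht2.ne']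
    have := hν _ ht
    rw [hz] at this
    simp only [sub_dotProduct, dotProduct_sub, smul_dotProduct, dotProduct_smul, smul_eq_mul,
      dotProduct_comm ν (e t)] at this
    have h5 : t ^ 2 * (2 * (e t ⬝ᵥ ν)) ≤ t ^ 2 * (t ^ 2 * (e t ⬝ᵥ e t)) := by linarith
    exact le_of_mul_le_mul_left h5 ht2
  have hl1 : Tendsto (fun t => 2 * (e t ⬝ᵥ ν)) (𝓝[>] 0) (𝓝 (2 * (lieBr X Y x ⬝ᵥ ν))) := by
    have hc : Continuous fun v : Fin n → ℝ => 2 * (v ⬝ᵥ ν) := by unfold dotProduct; fun_prop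
    exact (hc.tendsto _).comp hlim
  have hl2 : Tendsto (fun t : ℝ => t ^ 2 * (e t ⬝ᵥ e t)) (𝓝[>] 0) (𝓝 0) := by
    have hs : Tendsto (fun t : ℝ => t ^ 2) (𝓝[>] 0) (𝓝 0) := by
      have := ((continuous_pow 2).tendsto (0 : ℝ)).mono_left (nhdsWithin_le_nhds (s := Ioi 0))
      simpa using this
    simpa using hs.mul ((continuous_dotProduct_self.tendsto _).comp hlim)
  have := le_of_tendsto_of_tendsto hl1 hl2 hle
  linarith

/-- The Lie bracket of tangent fields is tangent. -/
theorem IsBonyTangent.lieBr {Ω F : Set (Fin n → ℝ)} (hΩ : IsOpen Ω)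
    (hFΩ : F ⊆ Ω) (hF : ∀ K ⊆ Ω, IsCompact K → IsCompact (F ∩ K))
    {X Y : (Fin n → ℝ) → (Fin n → ℝ)} (hX : ContDiffOn ℝ 1 X Ω) (hY : ContDiffOn ℝ 1 Y Ω)
    (hTX : IsBonyTangent F X) (hTY : IsBonyTangent F Y) : IsBonyTangent F (lieBr X Y) := by
  intro x hx ν hν
  have h1 := hTX.lieBr_dotProduct_nonpos hΩ hFΩ hF hX hY hTY hx hν
  have h2 := hTY.lieBr_dotProduct_nonpos hΩ hFΩ hF hY hX hTX hx hν
  have h3 : _root_.lieBr Y X x = -_root_.lieBr X Y x := by simp [_root_.lieBr]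
  rw [h3, neg_dotProduct] at h2
  linarith

/-- Every element of the Lie span of smooth tangent fields is smooth and tangent. -/
theorem LieSpan.contDiffOn_and_isBonyTangent {Ω F : Set (Fin n → ℝ)} (hΩ : IsOpen Ω)
    (hFΩ : F ⊆ Ω) (hF : ∀ K ⊆ Ω, IsCompact K → IsCompact (F ∩ K))
    {S : Set ((Fin n → ℝ) → (Fin n → ℝ))}
    (hS : ∀ X ∈ S, ContDiffOn ℝ (⊤ : ℕ∞) X Ω ∧ IsBonyTangent F X)
    {Z : (Fin n → ℝ) → (Fin n → ℝ)} (hZ : LieSpan Ω S Z) :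
    ContDiffOn ℝ (⊤ : ℕ∞) Z Ω ∧ IsBonyTangent F Z := by
  have h1 : ((1 : ℕ∞) : WithTop ℕ∞) ≤ ((⊤ : ℕ∞) : WithTop ℕ∞) := by exact_mod_cast le_top
  induction hZ with
  | base X hX => exact hS X hX
  | smul f X hf _ ih =>
    exact ⟨hf.smul ih.1, fun x hx ν hν => by rw [smul_dotProduct, ih.2 x hx ν hν, smul_zero]⟩
  | add X Y _ _ ihX ihY =>
    exact ⟨ihX.1.add ihY.1, fun x hx ν hν => by
      rw [add_dotProduct, ihX.2 x hx ν hν, ihY.2 x hx ν hν, add_zero]⟩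
  | bracket X Y _ _ ihX ihY =>
    refine ⟨?_, ihX.2.lieBr hΩ hFΩ hF (ihX.1.of_le h1) (ihY.1.of_le h1) ihY.2⟩
    exact ((ihY.1.fderiv_of_isOpen hΩ le_rfl).clm_apply ihX.1).sub
      ((ihX.1.fderiv_of_isOpen hΩ le_rfl).clm_apply ihY.1)

end Commutator

section Hopf

variable {n : ℕ}

/-- Second-order necessary condition at a local maximum, along a vector field. -/
theorem vApp_vApp_nonpos_of_isLocalMax {X : (Fin n → ℝ) → (Fin n → ℝ)} {w : (Fin n → ℝ) → ℝ}
    {x : Fin n → ℝ} (hX : DifferentiableAt ℝ X x) (hw : ContDiffAt ℝ 2 w x)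
    (hmax : IsLocalMax w x) : vApp X (vApp X w) x ≤ 0 := by
  have hd : DifferentiableAt ℝ (fderiv ℝ w) x :=
    (hw.fderiv_right (m := 1) (by norm_num)).differentiableAt one_ne_zero
  have hev : ∀ᶠ y in 𝓝 x, DifferentiableAt ℝ w y := by
    filter_upwards [hw.eventually (by simp)] with y hy using hy.differentiableAt two_ne_zero
  have hA : vApp X (vApp X w) x = fderiv ℝ (fderiv ℝ w) x (X x) (X x) := by
    have h : HasFDerivAt (vApp X w) _ x := hd.hasFDerivAt.clm_apply hX.hasFDerivAt
    rw [vApp, h.fderiv]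
    simp [hmax.fderiv_eq_zero]
  have hline : ∀ t : ℝ, HasDerivAt (fun s : ℝ => x + s • X x) (X x) t := fun t => by
    simpa using ((hasDerivAt_id t).smul_const (X x)).const_add x
  have htend : Tendsto (fun s : ℝ => x + s • X x) (𝓝 0) (𝓝 x) := by
    simpa using (hline 0).continuousAt.tendsto
  set g : ℝ → ℝ := fun t => w (x + t • X x) with hg
  have hg1 : deriv g =ᶠ[𝓝 0] fun t => fderiv ℝ w (x + t • X x) (X x) := by
    filter_upwards [htend.eventually hev] with t ht
    exact (ht.hasFDerivAt.comp_hasDerivAt t (hline t)).deriv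
  have hg2 : deriv (deriv g) 0 = fderiv ℝ (fderiv ℝ w) x (X x) (X x) := by
    rw [hg1.deriv_eq]
    have hd' : HasFDerivAt (fderiv ℝ w) (fderiv ℝ (fderiv ℝ w) x) (x + (0 : ℝ) • X x) := by
      simpa using hd.hasFDerivAt
    have h3 : HasDerivAt (fun t : ℝ => fderiv ℝ w (x + t • X x))
        (fderiv ℝ (fderiv ℝ w) x (X x)) 0 := hd'.comp_hasDerivAt (0 : ℝ) (hline 0)
    have h4 := ((ContinuousLinearMap.apply ℝ ℝ (X x)).hasFDerivAt
      (x := fderiv ℝ w (x + (0 : ℝ) • X x))).comp_hasDerivAt (0 : ℝ) h3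
    exact h4.deriv
  have hgmax : IsLocalMax g 0 := by
    have h : ∀ᶠ t : ℝ in 𝓝 0, w (x + t • X x) ≤ w x := htend.eventually hmax
    filter_upwards [h] with t ht
    simpa [hg] using ht
  rw [hA, ← hg2]
  by_contra! hpos
  have hcont : ContinuousAt g 0 := by
    have : ContinuousAt w (x + (0 : ℝ) • X x) := by simpa using hw.continuousAt
    exact ContinuousAt.comp (g := w) this (hline 0).continuousAt
  have hgmin := isLocalMin_of_deriv_deriv_pos hpos hgmax.deriv_eq_zero hcont
  have hconst : g =ᶠ[𝓝 0] fun _ => g 0 := by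
    filter_upwards [hgmax, hgmin] with t h1 h2 using le_antisymm h1 h2
  have h0 : deriv g =ᶠ[𝓝 0] fun _ => 0 := by
    simpa using hconst.deriv
  rw [h0.deriv_eq] at hpos
  simp at hpos

/-- The second-order operator `Σ_k X_k² u + Y u + a u`. -/
def hormanderOp {r : ℕ} (X : Fin r → ((Fin n → ℝ) → (Fin n → ℝ)))
    (Y : (Fin n → ℝ) → (Fin n → ℝ)) (a u : (Fin n → ℝ) → ℝ) (x : Fin n → ℝ) : ℝ :=
  (∑ k, vApp (X k) (vApp (X k) u) x) + vApp Y u x + a x * u x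

theorem vApp_add_const_mul {X : (Fin n → ℝ) → (Fin n → ℝ)} {u v : (Fin n → ℝ) → ℝ} {ε : ℝ}
    {x : Fin n → ℝ} (hu : DifferentiableAt ℝ u x) (hv : DifferentiableAt ℝ v x) :
    vApp X (fun y => u y + ε * v y) x = vApp X u x + ε * vApp X v x := by
  have h : HasFDerivAt (fun y => u y + ε * v y) (fderiv ℝ u x + ε • fderiv ℝ v x) x :=
    hu.hasFDerivAt.add (hv.hasFDerivAt.const_mul ε)
  simp [vApp, h.fderiv]

theorem contDiffOn_vApp {Ω : Set (Fin n → ℝ)} (hΩ : IsOpen Ω) {X : (Fin n → ℝ) → (Fin n → ℝ)}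
    {u : (Fin n → ℝ) → ℝ} {m k : WithTop ℕ∞} (hX : ContDiffOn ℝ m X Ω)
    (hu : ContDiffOn ℝ k u Ω) (hmk : m + 1 ≤ k) : ContDiffOn ℝ m (vApp X u) Ω :=
  (hu.fderiv_of_isOpen hΩ hmk).clm_apply hX

theorem hormanderOp_add_const_mul {Ω : Set (Fin n → ℝ)} (hΩ : IsOpen Ω) {r : ℕ}
    {X : Fin r → ((Fin n → ℝ) → (Fin n → ℝ))} {Y : (Fin n → ℝ) → (Fin n → ℝ)}
    {a u v : (Fin n → ℝ) → ℝ} {ε : ℝ} (hX : ∀ k, ContDiffOn ℝ 1 (X k) Ω)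
    (hu : ContDiffOn ℝ 2 u Ω) (hv : ContDiffOn ℝ 2 v Ω) {x : Fin n → ℝ} (hx : x ∈ Ω) :
    hormanderOp X Y a (fun y => u y + ε * v y) x =
      hormanderOp X Y a u x + ε * hormanderOp X Y a v x := by
  have hdiff : ∀ {f : (Fin n → ℝ) → ℝ} {k : WithTop ℕ∞}, ContDiffOn ℝ k f Ω → k ≠ 0 →
      ∀ y ∈ Ω, DifferentiableAt ℝ f y := fun h hk y hy =>
    (h.contDiffAt (hΩ.mem_nhds hy)).differentiableAt hk
  have h2 : ∀ k, vApp (X k) (vApp (X k) fun y => u y + ε * v y) x =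
      vApp (X k) (vApp (X k) u) x + ε * vApp (X k) (vApp (X k) v) x := by
    intro k
    have hev : vApp (X k) (fun y => u y + ε * v y) =ᶠ[𝓝 x]
        fun y => vApp (X k) u y + ε * vApp (X k) v y := by
      filter_upwards [hΩ.mem_nhds hx] with y hy
      exact vApp_add_const_mul (hdiff hu two_ne_zero y hy) (hdiff hv two_ne_zero y hy)
    rw [vApp, hev.fderiv_eq, ← vApp]
    exact vApp_add_const_mul
      (hdiff (contDiffOn_vApp hΩ (hX k) hu (by norm_num)) one_ne_zero x hx)
      (hdiff (contDiffOn_vApp hΩ (hX k) hv (by norm_num)) one_ne_zero x hx)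
  simp only [hormanderOp, h2, Finset.sum_add_distrib,
    vApp_add_const_mul (hdiff hu two_ne_zero x hx) (hdiff hv two_ne_zero x hx), ← Finset.mul_sum]
  ring

theorem vApp_polynomial {X : (Fin n → ℝ) → (Fin n → ℝ)} {s : (Fin n → ℝ) → ℝ} {K : ℝ}
    {x : Fin n → ℝ} (hs : DifferentiableAt ℝ s x) :
    vApp X (fun y => -s y + K * s y ^ 2) x = (-1 + 2 * K * s x) * vApp X s x := by
  have h := hs.hasFDerivAt.neg.add ((hs.hasFDerivAt.pow 2).const_mul K)
  have h' : HasFDerivAt (fun y => -s y + K * s y ^ 2) _ x := h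
  rw [vApp, h'.fderiv, vApp]
  simp
  ring

/-- Second derivative of `-s + K s²` along a field, at a zero of `s`. -/
theorem vApp_vApp_polynomial {X : (Fin n → ℝ) → (Fin n → ℝ)} {s : (Fin n → ℝ) → ℝ} {K : ℝ}
    {x : Fin n → ℝ} (hs : ContDiff ℝ 2 s) (hX : DifferentiableAt ℝ X x) (h0 : s x = 0) :
    vApp X (vApp X fun y => -s y + K * s y ^ 2) x =
      2 * K * vApp X s x ^ 2 - vApp X (vApp X s) x := by
  have hsd : Differentiable ℝ s := hs.differentiable two_ne_zero
  have hv : HasFDerivAt (vApp X s) (fderiv ℝ (vApp X s) x) x :=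
    (((hs.fderiv_right (m := 1) (by norm_num)).differentiable
      one_ne_zero x).clm_apply hX).hasFDerivAt
  have he : (vApp X fun y => -s y + K * s y ^ 2) =
      fun y => (-1 + 2 * K * s y) * vApp X s y := funext fun y => vApp_polynomial (hsd y)
  have h := (((hsd x).hasFDerivAt.const_mul (2 * K)).const_add (-1)).mul hv
  have h' : HasFDerivAt (fun y => (-1 + 2 * K * s y) * vApp X s y) _ x := h
  rw [he, vApp, h'.fderiv]
  simp [h0, vApp]
  ring

/-- Hopf-type lemma: each `X_k` is tangent to the set where a subsolution attains its
nonnegative maximum. -/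
theorem isBonyTangent_of_subsolution {Ω : Set (Fin n → ℝ)} (hΩ : IsOpen Ω) {r : ℕ}
    {X : Fin r → ((Fin n → ℝ) → (Fin n → ℝ))} {Y : (Fin n → ℝ) → (Fin n → ℝ)}
    {a u : (Fin n → ℝ) → ℝ} (hX : ∀ k, ContDiffOn ℝ 1 (X k) Ω) (hY : ContinuousOn Y Ω)
    (ha : ContinuousOn a Ω) (ha0 : ∀ x ∈ Ω, a x ≤ 0) (hu : ContDiffOn ℝ 2 u Ω)
    (hLu : ∀ x ∈ Ω, 0 ≤ hormanderOp X Y a u x) {M : ℝ} (hM : 0 ≤ M)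
    (hmax : ∀ x ∈ Ω, u x ≤ M) (k : Fin r) : IsBonyTangent {x | x ∈ Ω ∧ u x = M} (X k) := by
  rintro x₀ ⟨hx₀, hux₀⟩ ν hν
  by_contra hne
  set s : (Fin n → ℝ) → ℝ := fun y => (y - x₀) ⬝ᵥ (y - x₀) - (y - x₀) ⬝ᵥ ν with hs
  have hsc : ContDiff ℝ ⊤ s := by simp only [hs, dotProduct, Pi.sub_apply]; fun_prop
  have hs0 : s x₀ = 0 := by simp [hs]
  have hsF : ∀ z ∈ Ω, u z = M → z ≠ x₀ → 0 < s z := by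
    intro z hz huz hzx
    have h1 := hν z ⟨hz, huz⟩
    simp only [sub_dotProduct _ ν, dotProduct_sub _ _ ν, dotProduct_comm ν (z - x₀)] at h1
    have h2 : 0 < ‖z - x₀‖ ^ 2 := by
      have := norm_pos_iff.2 (sub_ne_zero.2 hzx); positivity
    have h3 := norm_sq_le_dotProduct_self (z - x₀)
    simp only [hs]
    linarith
  have hXs : vApp (X k) s x₀ ≠ 0 := by
    have hline : HasDerivAt (fun t : ℝ => x₀ + t • X k x₀) (X k x₀) 0 := by
      simpa using ((hasDerivAt_id (0 : ℝ)).smul_const (X k x₀)).const_add x₀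
    have hd : HasFDerivAt s (fderiv ℝ s x₀) (x₀ + (0 : ℝ) • X k x₀) := by
      simpa using (hsc.differentiable (by simp) x₀).hasFDerivAt
    have h1 := hd.comp_hasDerivAt 0 hline
    have h2 : HasDerivAt (fun t : ℝ => t ^ 2 * (X k x₀ ⬝ᵥ X k x₀) - t * (X k x₀ ⬝ᵥ ν))
        (-(X k x₀ ⬝ᵥ ν)) 0 := by
      simpa using ((hasDerivAt_pow 2 (0 : ℝ)).mul_const (X k x₀ ⬝ᵥ X k x₀)).fun_sub
        ((hasDerivAt_id (0 : ℝ)).mul_const (X k x₀ ⬝ᵥ ν))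
    have h3 : (s ∘ fun t : ℝ => x₀ + t • X k x₀) =
        fun t : ℝ => t ^ 2 * (X k x₀ ⬝ᵥ X k x₀) - t * (X k x₀ ⬝ᵥ ν) := by
      funext t
      simp only [hs, Function.comp, add_sub_cancel_left, smul_dotProduct, dotProduct_smul,
        smul_eq_mul]
      ring
    rw [h3] at h1
    have := h1.unique h2
    rw [vApp, this]
    exact neg_ne_zero.2 hne
  have hsq : 0 < ∑ j, vApp (X j) s x₀ ^ 2 :=
    lt_of_lt_of_le (by positivity) (Finset.single_le_sum (f := fun j => vApp (X j) s x₀ ^ 2)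
      (fun j _ => sq_nonneg _) (Finset.mem_univ k))
  set S := ∑ j, vApp (X j) s x₀ ^ 2 with hS
  set A := ∑ j, vApp (X j) (vApp (X j) s) x₀ + vApp Y s x₀ with hA
  obtain ⟨K, hK, hKA⟩ : ∃ K > 0, A < 2 * K * S := by
    refine ⟨(|A| + 1) / S, by positivity, ?_⟩
    have : 2 * ((|A| + 1) / S) * S = 2 * (|A| + 1) := by field_simp
    rw [this]
    linarith [le_abs_self A, abs_nonneg A]
  set v : (Fin n → ℝ) → ℝ := fun y => -s y + K * s y ^ 2 with hv
  have hvc : ContDiff ℝ ⊤ v := hsc.neg.add (contDiff_const.mul (hsc.pow 2))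
  have hv2 : ContDiffOn ℝ 2 v Ω := (hvc.of_le le_top).contDiffOn
  have hLv0 : 0 < hormanderOp X Y a v x₀ := by
    have hsum : ∑ j, vApp (X j) (vApp (X j) v) x₀ =
        2 * K * S - ∑ j, vApp (X j) (vApp (X j) s) x₀ := by
      rw [hS, Finset.mul_sum, ← Finset.sum_sub_distrib]
      exact Finset.sum_congr rfl fun j _ => vApp_vApp_polynomial (hsc.of_le le_top)
        (((hX j).contDiffAt (hΩ.mem_nhds hx₀)).differentiableAt one_ne_zero) hs0
    have hYv : vApp Y v x₀ = -vApp Y s x₀ := by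
      rw [hv, vApp_polynomial (hsc.differentiable (by simp) x₀), hs0]; ring
    rw [hormanderOp, hsum, hYv, show v x₀ = 0 by simp [hv, hs0]]
    linarith
  have hLvc : ContinuousAt (hormanderOp X Y a v) x₀ := by
    have h1 : ContinuousOn (hormanderOp X Y a v) Ω := by
      refine ((continuousOn_finsetSum _ fun j _ => ?_).add ?_).add (ha.mul hv2.continuousOn)
      · exact (contDiffOn_vApp hΩ ((hX j).of_le zero_le_one)
          (contDiffOn_vApp hΩ (hX j) hv2 (by norm_num)) (by norm_num)).continuousOn
      · exact (contDiffOn_vApp hΩ (contDiffOn_zero.2 hY) hv2 (by norm_num)).continuousOn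
    exact h1.continuousAt (hΩ.mem_nhds hx₀)
  have hsK : ∀ᶠ y in 𝓝 x₀, K * s y < 1 := by
    have : ContinuousAt (fun y => K * s y) x₀ := (hsc.continuous.const_mul K).continuousAt
    exact this.eventually (gt_mem_nhds (by simp [hs0]))
  obtain ⟨ρ, hρ, hρs⟩ := Metric.nhds_basis_closedBall.mem_iff.1
    ((hLvc.eventually (lt_mem_nhds hLv0)).and (hsK.and (hΩ.mem_nhds hx₀)))
  have hVΩ : closedBall x₀ ρ ⊆ Ω := fun y hy => (hρs hy).2.2
  have huV : ContinuousOn u (closedBall x₀ ρ) := hu.continuousOn.mono hVΩ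
  obtain ⟨ε, hε, hεs⟩ : ∃ ε > 0, ∀ y ∈ sphere x₀ ρ, u y + ε * v y < M := by
    set B := sphere x₀ ρ ∩ {y | 0 ≤ v y} with hB
    have hBc : IsCompact B := (isCompact_sphere _ _).inter_right
      (isClosed_le continuous_const hvc.continuous)
    have hout : ∀ ε > 0, ∀ y ∈ sphere x₀ ρ, y ∉ B → u y + ε * v y < M := by
      intro ε hε y hy hyB
      have hvy : v y < 0 := by
        by_contra! h
        exact hyB ⟨hy, h⟩
      nlinarith [hmax y (hVΩ (sphere_subset_closedBall hy))]
    rcases B.eq_empty_or_nonempty with hemp | hne'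
    · exact ⟨1, one_pos, fun y hy => hout 1 one_pos y hy (by simp [hemp])⟩
    obtain ⟨y₁, hy₁, h₁⟩ := hBc.exists_isMaxOn hne'
      (huV.mono (inter_subset_left.trans sphere_subset_closedBall))
    obtain ⟨y₂, hy₂, h₂⟩ := hBc.exists_isMaxOn hne' hvc.continuous.continuousOn
    have hlt : u y₁ < M := by
      have hy₁' := sphere_subset_closedBall hy₁.1
      refine lt_of_le_of_ne (hmax _ (hVΩ hy₁')) fun he => ?_
      have hpos := hsF y₁ (hVΩ hy₁') he (ne_of_mem_sphere hy₁.1 hρ.ne')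
      have hKs : K * s y₁ < 1 := (hρs hy₁').2.1
      have hvy : 0 ≤ -s y₁ + K * s y₁ ^ 2 := hy₁.2
      nlinarith
    have hv₂ : 0 ≤ v y₂ := hy₂.2
    refine ⟨(M - u y₁) / (v y₂ + 1), div_pos (by linarith) (by linarith), fun y hy => ?_⟩
    by_cases hyB : y ∈ B
    · have e1 : u y ≤ u y₁ := h₁ hyB
      have e2 : v y ≤ v y₂ := h₂ hyB
      have e3 : (M - u y₁) / (v y₂ + 1) * v y < M - u y₁ := by
        rw [div_mul_eq_mul_div, div_lt_iff₀ (by linarith)]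
        exact mul_lt_mul_of_pos_left (by linarith) (by linarith)
      linarith
    · exact hout _ (div_pos (by linarith) (by linarith)) y hy hyB
  obtain ⟨x₁, hx₁, hx₁max⟩ := (isCompact_closedBall x₀ ρ).exists_isMaxOn
    ⟨x₀, mem_closedBall_self hρ.le⟩ (huV.add (hvc.continuous.const_mul ε).continuousOn)
  have hge : M ≤ u x₁ + ε * v x₁ := by
    have : u x₀ + ε * v x₀ ≤ u x₁ + ε * v x₁ := hx₁max (mem_closedBall_self hρ.le)
    simpa [hv, hs0, hux₀] using this
  have hx₁b : x₁ ∈ ball x₀ ρ := by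
    refine lt_of_le_of_ne (mem_closedBall.1 hx₁) fun he => ?_
    linarith [hεs x₁ he]
  have hloc : IsLocalMax (fun y => u y + ε * v y) x₁ :=
    hx₁max.isLocalMax (mem_of_superset (isOpen_ball.mem_nhds hx₁b) ball_subset_closedBall)
  have hx₁Ω := hVΩ hx₁
  have hwc : ContDiffAt ℝ 2 (fun y => u y + ε * v y) x₁ :=
    (hu.add (contDiffOn_const.mul hv2)).contDiffAt (hΩ.mem_nhds hx₁Ω)
  have hle : hormanderOp X Y a (fun y => u y + ε * v y) x₁ ≤ 0 := by
    have e1 : ∑ j, vApp (X j) (vApp (X j) fun y => u y + ε * v y) x₁ ≤ 0 :=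
      Finset.sum_nonpos fun j _ => vApp_vApp_nonpos_of_isLocalMax
        (((hX j).contDiffAt (hΩ.mem_nhds hx₁Ω)).differentiableAt one_ne_zero) hwc hloc
    have e2 : vApp Y (fun y => u y + ε * v y) x₁ = 0 := by
      simp [vApp, hloc.fderiv_eq_zero]
    have e3 : a x₁ * (u x₁ + ε * v x₁) ≤ 0 :=
      mul_nonpos_of_nonpos_of_nonneg (ha0 _ hx₁Ω) (hM.trans hge)
    rw [hormanderOp, e2]
    linarith
  rw [hormanderOp_add_const_mul hΩ hX hu hv2 hx₁Ω] at hle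
  have hLv1 : 0 < hormanderOp X Y a v x₁ := (hρs hx₁).1
  have := mul_pos hε hLv1
  linarith [hLu x₁ hx₁Ω]

end Hopf

/-- Theorem A7 / Bony's Theorem 3.1.
Let `Lu = Σ_k X_k² u + Yu + au` with `X₁,...,X_r`, `Y` smooth vector fields and
`a ≤ 0` smooth on `Ω`. If `u ∈ C²(Ω)` satisfies `Lu ≥ 0` and attains a nonnegative
maximum over `Ω` at a point of an integral curve `Γ` of some `Z ∈ £(X₁,...,X_r)`,
then `u` equals that maximum at every point of `Γ`. -/
theorem strong_max_principle_Bony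
    (n : ℕ) (Ω : Set (Fin n → ℝ)) (hΩ : IsOpen Ω) (hΩconn : IsConnected Ω)
    (r : ℕ) (X : Fin r → ((Fin n → ℝ) → (Fin n → ℝ))) (Y : (Fin n → ℝ) → (Fin n → ℝ))
    (a : (Fin n → ℝ) → ℝ)
    (hX : ∀ k, ContDiffOn ℝ (⊤ : ℕ∞) (X k) Ω)
    (hY : ContDiffOn ℝ (⊤ : ℕ∞) Y Ω)
    (ha : ContDiffOn ℝ (⊤ : ℕ∞) a Ω) (ha0 : ∀ x ∈ Ω, a x ≤ 0)
    (u : (Fin n → ℝ) → ℝ) (hu : ContDiffOn ℝ 2 u Ω)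
    (hLu : ∀ x ∈ Ω, 0 ≤ (∑ k, vApp (X k) (vApp (X k) u) x) + vApp Y u x + a x * u x)
    (Z : (Fin n → ℝ) → (Fin n → ℝ)) (hZ : LieSpan Ω (Set.range X) Z)
    (I : Set ℝ) (hIopen : IsOpen I) (hIconn : IsPreconnected I)
    (γ : ℝ → (Fin n → ℝ)) (hγΩ : ∀ t ∈ I, γ t ∈ Ω)
    (hγ : ∀ t ∈ I, HasDerivAt γ (Z (γ t)) t)
    (t₀ : ℝ) (ht₀ : t₀ ∈ I)
    (hmax : ∀ x ∈ Ω, u x ≤ u (γ t₀)) (hnn : 0 ≤ u (γ t₀)) :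
    ∀ t ∈ I, u (γ t) = u (γ t₀) := by
  have h1 : ((1 : ℕ∞) : WithTop ℕ∞) ≤ ((⊤ : ℕ∞) : WithTop ℕ∞) := by exact_mod_cast le_top
  set F : Set (Fin n → ℝ) := {x | x ∈ Ω ∧ u x = u (γ t₀)}
  have hFΩ : F ⊆ Ω := fun x hx => hx.1
  have hF : ∀ K ⊆ Ω, IsCompact K → IsCompact (F ∩ K) := by
    intro K hK hKc
    have hcl := (hu.continuousOn.mono hK).preimage_isClosed_of_isClosed hKc.isClosed
      (isClosed_singleton (x := u (γ t₀)))
    refine hKc.of_isClosed_subset (?_ : IsClosed (F ∩ K)) inter_subset_right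
    have he : F ∩ K = K ∩ u ⁻¹' {u (γ t₀)} := by
      ext x
      exact ⟨fun h => ⟨h.2, h.1.2⟩, fun h => ⟨⟨hK h.1, h.2⟩, h.1⟩⟩
    rwa [he]
  obtain ⟨hZc, hZT⟩ := hZ.contDiffOn_and_isBonyTangent hΩ hFΩ hF (by
    rintro _ ⟨k, rfl⟩
    exact ⟨hX k, isBonyTangent_of_subsolution hΩ (fun k => (hX k).of_le h1) hY.continuousOn
      ha.continuousOn ha0 hu hLu hnn hmax k⟩)
  intro t ht
  exact (hZT.mem_of_integralCurve hΩ hFΩ hF (hZc.of_le h1) hIopen hIconn hγΩ hγ ht₀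
    ⟨hγΩ t₀ ht₀, rfl⟩ t ht).2
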